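/- arXiv:1310.2410 — 2 statements merged into one kernel-verified Lean document; each statement's English description precedes it below -/
import Mathlib

section
/- Let 0 < q < 1, let k be a positive integer, let s > 0 be a real number, and let A ∈ ℝ^{n×p}. Suppose x ∈ ℝ^p is k-sparse and y = Ax. If the ⌈(s^q+1)k⌉-order restricted isometry constant of A satisfies δ_{(s^q+1)k} < 1/√(s^{q-2}+1), then any minimizer x̂ of ‖w‖_q^q subject to Aw = y satisfies x̂ = x; i.e., ℓq minimization recovers x exactly. -/
open scoped BigOperators

/-- `‖v‖_q^q = ∑ |v i|^q` for `v ∈ ℝ^p`. -/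
noncomputable def lqq (q : ℝ) {p : ℕ} (v : Fin p → ℝ) : ℝ := ∑ i, |v i| ^ q

/-- The `ℓ_q` quasinorm `(∑ |v i|^q)^(1/q)`. -/
noncomputable def lqNorm (q : ℝ) {p : ℕ} (v : Fin p → ℝ) : ℝ := (∑ i, |v i| ^ q) ^ (1/q)

/-- Euclidean norm on `ℝ^p`. -/
noncomputable def l2Norm {p : ℕ} (v : Fin p → ℝ) : ℝ := Real.sqrt (∑ i, (v i) ^ 2)

/-- `ℓ_1` norm on `ℝ^p`. -/
noncomputable def l1Norm {p : ℕ} (v : Fin p → ℝ) : ℝ := ∑ i, |v i|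

/-- `ℓ_∞` norm on `ℝ^p`. -/
noncomputable def linfNorm {p : ℕ} (v : Fin p → ℝ) : ℝ := ⨆ i, |v i|

open Classical in
/-- `‖v‖_0`: number of nonzero entries of `v`. -/
noncomputable def l0 {p : ℕ} (v : Fin p → ℝ) : ℕ := (Finset.univ.filter (fun i => v i ≠ 0)).card

/-- `v` is `k`-sparse if it has at most `k` nonzero entries. -/
def Sparse {p : ℕ} (k : ℕ) (v : Fin p → ℝ) : Prop := l0 v ≤ k

/-- The `m`-order restricted isometry constant of `A`: the infimum of those `δ ≥ 0` such
that `(1-δ)‖x‖₂² ≤ ‖Ax‖₂² ≤ (1+δ)‖x‖₂²` for all `m`-sparse `x`. -/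
noncomputable def ric {n p : ℕ} (A : Matrix (Fin n) (Fin p) ℝ) (m : ℕ) : ℝ :=
  sInf {δ : ℝ | 0 ≤ δ ∧ ∀ x : Fin p → ℝ, Sparse m x →
    (1 - δ) * (∑ i, (x i) ^ 2) ≤ (∑ i, (A.mulVec x i) ^ 2) ∧
    (∑ i, (A.mulVec x i) ^ 2) ≤ (1 + δ) * (∑ i, (x i) ^ 2)}

/-- The spectral norm of `A`: the least `c ≥ 0` with `‖Av‖₂ ≤ c‖v‖₂` for all `v`. -/
noncomputable def specNorm {n p : ℕ} (A : Matrix (Fin n) (Fin p) ℝ) : ℝ :=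
  sInf {c : ℝ | 0 ≤ c ∧ ∀ v : Fin p → ℝ, l2Norm (A.mulVec v) ≤ c * l2Norm v}

/-- `vk` is a version of `v` with all but the `k` largest-magnitude entries set to zero. -/
def IsMaxK {p : ℕ} (k : ℕ) (v vk : Fin p → ℝ) : Prop :=
  ∃ T : Finset (Fin p), T.card = min k p ∧
    (∀ i ∈ T, ∀ j ∉ T, |v j| ≤ |v i|) ∧
    vk = fun i => if i ∈ T then v i else 0


/-- Linear optimisation over a truncated cube: sparse points dominate. -/
lemma aux_two_frac {p : ℕ} (a : ℝ) (ha : 0 < a) (N : ℕ) (v : Fin p → ℝ)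
    (h0 : ∀ i, 0 ≤ v i) (h1 : ∀ i, v i ≤ a) (hs : ∑ i, v i ≤ N * a)
    (hc : N < (Finset.univ.filter (fun i => v i ≠ 0)).card) :
    ∃ i j, i ≠ j ∧ 0 < v i ∧ v i < a ∧ 0 < v j ∧ v j < a := by
  classical
  set S := Finset.univ.filter (fun i => v i ≠ 0) with hS
  set F := Finset.univ.filter (fun i => 0 < v i ∧ v i < a) with hF
  by_cases hF1 : 1 < F.card
  · obtain ⟨i, hi, j, hj, hij⟩ := Finset.one_lt_card.1 hF1
    simp only [hF, Finset.mem_filter, Finset.mem_univ, true_and] at hi hj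
    exact ⟨i, j, hij, hi.1, hi.2, hj.1, hj.2⟩
  · exfalso
    have hFS : F ⊆ S := by
      intro i hi
      simp only [hF, hS, Finset.mem_filter, Finset.mem_univ, true_and] at hi ⊢
      exact hi.1.ne'
    have hsum : ∑ i, v i = ∑ i ∈ S \ F, v i + ∑ i ∈ F, v i := by
      rw [Finset.sum_sdiff hFS]
      symm
      apply Finset.sum_subset (Finset.subset_univ _)
      intro i _ hi
      simpa [hS] using hi
    have hD : ∑ i ∈ S \ F, v i = ((S \ F).card : ℝ) * a := by
      rw [Finset.sum_congr rfl (g := fun _ => a), Finset.sum_const, nsmul_eq_mul]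
      intro i hi
      simp only [hF, hS, Finset.mem_sdiff, Finset.mem_filter, Finset.mem_univ, true_and,
        not_and, not_lt] at hi
      exact le_antisymm (h1 i) (hi.2 (lt_of_le_of_ne (h0 i) (Ne.symm hi.1)))
    have hcard := Finset.card_sdiff_add_card_eq_card hFS
    rcases Nat.eq_zero_or_pos F.card with hz | hz
    · have hDc : N + 1 ≤ (S \ F).card := by omega
      have hDc' : (N : ℝ) + 1 ≤ ((S \ F).card : ℝ) := by exact_mod_cast hDc
      have : 0 ≤ ∑ i ∈ F, v i := Finset.sum_nonneg fun i _ => h0 i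
      nlinarith
    · have hDc : N ≤ (S \ F).card := by omega
      have hDc' : (N : ℝ) ≤ ((S \ F).card : ℝ) := by exact_mod_cast hDc
      have : 0 < ∑ i ∈ F, v i := by
        apply Finset.sum_pos
        · intro i hi
          simp only [hF, Finset.mem_filter, Finset.mem_univ, true_and] at hi
          exact hi.1
        · exact Finset.card_pos.1 hz
      nlinarith

lemma aux_sparse {p : ℕ} (a : ℝ) (ha : 0 < a) (N : ℕ) (c : Fin p → ℝ) :
    ∀ (f : ℕ) (v : Fin p → ℝ), (Finset.univ.filter (fun i => 0 < v i ∧ v i < a)).card ≤ f →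
    (∀ i, 0 ≤ v i) → (∀ i, v i ≤ a) → ∑ i, v i ≤ N * a →
    ∃ u : Fin p → ℝ, (∀ i, 0 ≤ u i) ∧ (∀ i, u i ≤ a) ∧
      (Finset.univ.filter (fun i => u i ≠ 0)).card ≤ N ∧ (∀ i, v i = 0 → u i = 0) ∧
      ∑ i, c i * v i ≤ ∑ i, c i * u i := by
  classical
  intro f
  induction f with
  | zero =>
    intro v hf h0 h1 hs
    by_cases hc : (Finset.univ.filter (fun i => v i ≠ 0)).card ≤ N
    · exact ⟨v, h0, h1, hc, fun _ h => h, le_rfl⟩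
    · exfalso
      obtain ⟨i, j, hij, hi, hi', hj, hj'⟩ := aux_two_frac a ha N v h0 h1 hs (not_le.1 hc)
      have : i ∈ Finset.univ.filter (fun i => 0 < v i ∧ v i < a) := by simp [hi, hi']
      have := Finset.card_pos.2 ⟨i, this⟩
      omega
  | succ f ih =>
    intro v hf h0 h1 hs
    by_cases hc : (Finset.univ.filter (fun i => v i ≠ 0)).card ≤ N
    · exact ⟨v, h0, h1, hc, fun _ h => h, le_rfl⟩
    obtain ⟨i, j, hij, hi, hi', hj, hj', hcc⟩ : ∃ i j, i ≠ j ∧ 0 < v i ∧ v i < a ∧ 0 < v j ∧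
        v j < a ∧ c j ≤ c i := by
      obtain ⟨i, j, hij, hi, hi', hj, hj'⟩ := aux_two_frac a ha N v h0 h1 hs (not_le.1 hc)
      rcases le_total (c j) (c i) with h | h
      · exact ⟨i, j, hij, hi, hi', hj, hj', h⟩
      · exact ⟨j, i, hij.symm, hj, hj', hi, hi', h⟩
    set e := min (a - v i) (v j) with he
    have hepos : 0 < e := lt_min (by linarith) hj
    have he1 : e ≤ a - v i := min_le_left _ _
    have he2 : e ≤ v j := min_le_right _ _
    set w : Fin p → ℝ := v + Pi.single i e - Pi.single j e with hw
    have hwi : w i = v i + e := by simp [hw, hij]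
    have hwj : w j = v j - e := by simp [hw, hij.symm]
    have hwo : ∀ l, l ≠ i → l ≠ j → w l = v l := by
      intro l h1 h2; simp [hw, h1, h2]
    have hsumc : ∀ d : Fin p → ℝ, ∑ l, d l * w l = ∑ l, d l * v l + d i * e - d j * e := by
      intro d
      simp only [hw, Pi.add_apply, Pi.sub_apply, mul_sub, mul_add, Finset.sum_sub_distrib,
        Finset.sum_add_distrib, Pi.single_apply, mul_ite, mul_zero, Finset.sum_ite_eq',
        Finset.mem_univ, if_true]
    have hw0 : ∀ l, 0 ≤ w l := by
      intro l
      by_cases hli : l = i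
      · subst hli; rw [hwi]; linarith
      by_cases hlj : l = j
      · subst hlj; rw [hwj]; linarith
      rw [hwo l hli hlj]; exact h0 l
    have hw1 : ∀ l, w l ≤ a := by
      intro l
      by_cases hli : l = i
      · subst hli; rw [hwi]; linarith
      by_cases hlj : l = j
      · subst hlj; rw [hwj]; linarith
      rw [hwo l hli hlj]; exact h1 l
    have hws : ∑ l, w l ≤ N * a := by
      have := hsumc (fun _ => 1)
      simp only [one_mul] at this
      linarith
    have hlt : (Finset.univ.filter (fun i => 0 < w i ∧ w i < a)).card <
        (Finset.univ.filter (fun i => 0 < v i ∧ v i < a)).card := by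
      apply Finset.card_lt_card
      rw [Finset.ssubset_iff_of_subset]
      · rcases min_choice (a - v i) (v j) with h | h
        · refine ⟨i, by simp [hi, hi'], ?_⟩
          simp only [Finset.mem_filter, Finset.mem_univ, true_and, not_and, not_lt]
          intro _; rw [hwi, he, h]; linarith
        · refine ⟨j, by simp [hj, hj'], ?_⟩
          simp only [Finset.mem_filter, Finset.mem_univ, true_and, not_and, not_lt]
          intro hh; rw [hwj, he, h] at hh; linarith
      · intro l hl
        simp only [Finset.mem_filter, Finset.mem_univ, true_and] at hl ⊢
        by_cases hli : l = i
        · subst hli; exact ⟨hi, hi'⟩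
        by_cases hlj : l = j
        · subst hlj; exact ⟨hj, hj'⟩
        rwa [hwo l hli hlj] at hl
    obtain ⟨u, hu0, hu1, huc, hus, huu⟩ := ih w (by omega) hw0 hw1 hws
    refine ⟨u, hu0, hu1, huc, ?_, ?_⟩
    · intro l hl
      apply hus
      rw [hwo l _ _]
      · exact hl
      · rintro rfl; linarith
      · rintro rfl; linarith
    · have := hsumc c
      nlinarith

/-- Signed version. -/
lemma aux_sparse_signed {p : ℕ} (a : ℝ) (ha : 0 < a) (N : ℕ) (c v : Fin p → ℝ)
    (h1 : ∀ i, |v i| ≤ a) (hs : ∑ i, |v i| ≤ N * a) :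
    ∃ u : Fin p → ℝ, (Finset.univ.filter (fun i => u i ≠ 0)).card ≤ N ∧
      (∀ i, v i = 0 → u i = 0) ∧ ∑ i, (u i) ^ 2 ≤ N * a ^ 2 ∧
      ∑ i, c i * v i ≤ ∑ i, c i * u i := by
  classical
  obtain ⟨u, hu0, hu1, huc, hus, huu⟩ := aux_sparse a ha N
    (fun i => c i * SignType.sign (v i)) _ (fun i => |v i|) le_rfl (fun i => abs_nonneg _) h1 hs
  have hcard : (Finset.univ.filter (fun i => (SignType.sign (v i) : ℝ) * u i ≠ 0)).card ≤ N := by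
    refine le_trans (Finset.card_le_card ?_) huc
    intro i hi
    simp only [Finset.mem_filter, Finset.mem_univ, true_and] at hi ⊢
    exact right_ne_zero_of_mul hi
  refine ⟨fun i => SignType.sign (v i) * u i, hcard, ?_, ?_, ?_⟩
  · intro i hi; simp [hi]
  · rw [← Finset.sum_filter_of_ne (p := fun i => (SignType.sign (v i) : ℝ) * u i ≠ 0)]
    · refine le_trans (Finset.sum_le_card_nsmul _ _ (a ^ 2) ?_) ?_
      · intro i _
        have hsq : ((SignType.sign (v i) : ℝ)) ^ 2 ≤ 1 := by
          rcases lt_trichotomy (v i) 0 with h | h | h <;> simp [h]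
        have := pow_le_pow_left₀ (hu0 i) (hu1 i) 2
        rw [mul_pow]
        nlinarith [sq_nonneg (u i)]
      · rw [nsmul_eq_mul]
        have : ((Finset.univ.filter
          (fun i => (SignType.sign (v i) : ℝ) * u i ≠ 0)).card : ℝ) ≤ N := by exact_mod_cast hcard
        exact mul_le_mul_of_nonneg_right this (sq_nonneg a)
    · intro i _ h h'; apply h; simp [h']
  · calc ∑ i, c i * v i = ∑ i, c i * SignType.sign (v i) * |v i| := by
          refine Finset.sum_congr rfl fun i _ => ?_
          rw [mul_assoc, sign_mul_abs]
      _ ≤ _ := huu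
      _ = _ := Finset.sum_congr rfl fun i _ => by ring

/-- The ric set is nonempty. -/
lemma aux_ric {n p : ℕ} (A : Matrix (Fin n) (Fin p) ℝ) (m : ℕ) (b : ℝ) (h : ric A m < b) :
    ∃ δ : ℝ, δ < b ∧ 0 ≤ δ ∧ ∀ x : Fin p → ℝ, Sparse m x →
    (1 - δ) * (∑ i, (x i) ^ 2) ≤ (∑ i, (A.mulVec x i) ^ 2) ∧
    (∑ i, (A.mulVec x i) ^ 2) ≤ (1 + δ) * (∑ i, (x i) ^ 2) := by
  unfold ric at h
  obtain ⟨δ, hδ, hlt⟩ := exists_lt_of_csInf_lt (by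
    have hC : 0 ≤ ∑ i, ∑ j, (A i j) ^ 2 :=
      Finset.sum_nonneg fun i _ => Finset.sum_nonneg fun j _ => sq_nonneg _
    refine ⟨1 + ∑ i, ∑ j, (A i j) ^ 2, by linarith, fun x _ => ?_⟩
    have hx : 0 ≤ ∑ i, (x i) ^ 2 := Finset.sum_nonneg fun i _ => sq_nonneg _
    have hA : 0 ≤ ∑ i, (A.mulVec x i) ^ 2 := Finset.sum_nonneg fun i _ => sq_nonneg _
    have hle : ∑ i, (A.mulVec x i) ^ 2 ≤ (∑ i, ∑ j, (A i j) ^ 2) * ∑ i, (x i) ^ 2 := by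
      rw [Finset.sum_mul]
      refine Finset.sum_le_sum fun i _ => ?_
      exact Finset.sum_mul_sq_le_sq_mul_sq Finset.univ (fun j => A i j) x
    constructor <;> nlinarith [mul_nonneg hC hx]) h
  exact ⟨δ, hlt, hδ.1, hδ.2⟩

/-- Cone condition. -/
lemma aux_cone {p : ℕ} (q : ℝ) (hq0 : 0 < q) (hq1 : q < 1) (x z : Fin p → ℝ)
    (T : Finset (Fin p)) (hT : ∀ i ∉ T, x i = 0) (h : lqq q z ≤ lqq q x) :
    ∑ i ∈ Tᶜ, |z i - x i| ^ q ≤ ∑ i ∈ T, |z i - x i| ^ q := by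
  unfold lqq at h
  rw [← Finset.sum_add_sum_compl T, ← Finset.sum_add_sum_compl T (fun i => |x i| ^ q)] at h
  have e1 : ∑ i ∈ Tᶜ, |x i| ^ q = 0 := by
    apply Finset.sum_eq_zero
    intro i hi
    rw [hT i (by simpa using hi), abs_zero, Real.zero_rpow hq0.ne']
  have e2 : ∑ i ∈ Tᶜ, |z i - x i| ^ q = ∑ i ∈ Tᶜ, |z i| ^ q := by
    refine Finset.sum_congr rfl fun i hi => ?_
    rw [hT i (by simpa using hi), sub_zero]
  have e3 : ∑ i ∈ T, |x i| ^ q ≤ ∑ i ∈ T, |z i| ^ q + ∑ i ∈ T, |z i - x i| ^ q := by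
    rw [← Finset.sum_add_distrib]
    refine Finset.sum_le_sum fun i _ => ?_
    refine le_trans ?_ (Real.rpow_add_le_add_rpow (abs_nonneg _) (abs_nonneg _) hq0.le hq1.le)
    apply Real.rpow_le_rpow (abs_nonneg _) _ hq0.le
    have := abs_sub (z i) (z i - x i)
    rwa [sub_sub_cancel] at this
  linarith

/-- Power mean estimate. -/
lemma aux_power {p : ℕ} (q : ℝ) (hq0 : 0 < q) (hq1 : q < 1) (h : Fin p → ℝ)
    (T : Finset (Fin p)) (k l : ℕ) (hk : 0 < k) (hT : T.card ≤ k) (s : ℝ) (hs : 0 < s)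
    (hl : s ^ q * k ≤ l) (a : ℝ) (ha : 0 < a) (hR : l * a ^ q = ∑ i ∈ T, |h i| ^ q) :
    l * a ^ 2 ≤ s ^ (q - 2) * ∑ i ∈ T, (h i) ^ 2 := by
  have hk' : (0 : ℝ) < k := by exact_mod_cast hk
  have hsq : 0 < s ^ q := Real.rpow_pos_of_pos hs q
  have hl0 : (0 : ℝ) < l := lt_of_lt_of_le (by positivity) hl
  have h2q : 1 ≤ 2 / q := by rw [le_div_iff₀ hq0]; linarith
  have hH : 0 ≤ ∑ i ∈ T, (h i) ^ 2 := Finset.sum_nonneg fun i _ => sq_nonneg _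
  have hpm := Real.rpow_sum_le_const_mul_sum_rpow T (fun i => |h i| ^ q) h2q
  have hsimp : ∀ y : ℝ, 0 ≤ y → (y ^ q) ^ (2 / q) = y ^ 2 := by
    intro y hy
    rw [← Real.rpow_mul hy, mul_div_cancel₀ _ hq0.ne', Real.rpow_two]
  have e1 : ∑ i ∈ T, |(|h i| ^ q)| ^ (2 / q) = ∑ i ∈ T, (h i) ^ 2 := by
    refine Finset.sum_congr rfl fun i _ => ?_
    rw [abs_of_nonneg (Real.rpow_nonneg (abs_nonneg _) _), hsimp _ (abs_nonneg _), sq_abs]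
  have e2 : ∑ i ∈ T, |(|h i| ^ q)| = l * a ^ q := by
    rw [hR]
    refine Finset.sum_congr rfl fun i _ => ?_
    rw [abs_of_nonneg (Real.rpow_nonneg (abs_nonneg _) _)]
  rw [e1, e2, Real.mul_rpow hl0.le (Real.rpow_nonneg ha.le _), hsimp a ha.le] at hpm
  have h3 : (T.card : ℝ) ^ (2 / q - 1) ≤ (k : ℝ) ^ (2 / q - 1) :=
    Real.rpow_le_rpow (by positivity) (by exact_mod_cast hT) (by linarith)
  have h4 : (k : ℝ) ^ (2 / q - 1) ≤ s ^ (q - 2) * (l : ℝ) ^ (2 / q - 1) := by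
    have h5 : (s ^ q * k) ^ (2 / q - 1) ≤ (l : ℝ) ^ (2 / q - 1) :=
      Real.rpow_le_rpow (by positivity) hl (by linarith)
    rw [Real.mul_rpow hsq.le hk'.le, ← Real.rpow_mul hs.le] at h5
    have h6 : q * (2 / q - 1) = 2 - q := by field_simp
    rw [h6] at h5
    calc (k : ℝ) ^ (2 / q - 1) = s ^ (q - 2) * (s ^ (2 - q) * (k : ℝ) ^ (2 / q - 1)) := by
          rw [← mul_assoc, ← Real.rpow_add hs]; simp
      _ ≤ _ := mul_le_mul_of_nonneg_left h5 (Real.rpow_nonneg hs.le _)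
  have h7 : (l : ℝ) ^ (2 / q) = (l : ℝ) ^ (2 / q - 1) * l := by
    rw [Real.rpow_sub_one hl0.ne']; field_simp
  have hlp : 0 < (l : ℝ) ^ (2 / q - 1) := Real.rpow_pos_of_pos hl0 _
  rw [h7] at hpm
  have h8 : (l : ℝ) ^ (2 / q - 1) * (l * a ^ 2) ≤
      (l : ℝ) ^ (2 / q - 1) * (s ^ (q - 2) * ∑ i ∈ T, (h i) ^ 2) := by
    have := mul_le_mul_of_nonneg_right (h3.trans h4) hH
    nlinarith
  exact le_of_mul_le_mul_left h8 hlp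

/-- Final scalar contradiction. -/
lemma aux_scalar (δ θ G U P Q V : ℝ) (hδ : 0 ≤ δ) (hθ : 0 < θ) (hd : δ ^ 2 * (1 + θ) < 1)
    (hG : 0 < G) (hU : U ≤ θ * G) (hPQ : P + Q ≤ 0)
    (hup : ∀ a b : ℝ, a ^ 2 * P + 2 * a * b * Q + b ^ 2 * V ≤ (1 + δ) * (a ^ 2 * G + b ^ 2 * U))
    (hlo : ∀ a b : ℝ, (1 - δ) * (a ^ 2 * G + b ^ 2 * U) ≤ a ^ 2 * P + 2 * a * b * Q + b ^ 2 * V) :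
    False := by
  obtain ⟨μ, hμ0, hμ1, hμ⟩ : ∃ μ : ℝ, 0 < μ ∧ μ < 1 ∧
      μ ^ 2 * (1 + δ + δ * θ / 2) - (1 + δ) * μ + δ / 2 < 0 := by
    have hD : 0 < 1 + δ + δ * θ / 2 := by positivity
    refine ⟨(1 + δ) / (2 * (1 + δ + δ * θ / 2)), by positivity, ?_, ?_⟩
    · rw [div_lt_one (by positivity)]
      nlinarith [mul_nonneg hδ hθ.le]
    · have : ((1 + δ) / (2 * (1 + δ + δ * θ / 2))) ^ 2 * (1 + δ + δ * θ / 2)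
          - (1 + δ) * ((1 + δ) / (2 * (1 + δ + δ * θ / 2))) + δ / 2
          = (δ ^ 2 * (1 + θ) - 1) / (4 * (1 + δ + δ * θ / 2)) := by
        field_simp
        ring
      rw [this]
      exact div_neg_of_neg_of_pos (by linarith) (by positivity)
  have h1 := hup (1 / 2 - μ) (-(μ / 2))
  have h2 := hlo (1 / 2) (μ / 2)
  have h3 : 0 ≤ μ * (1 - μ) * (-(P + Q)) :=
    mul_nonneg (mul_nonneg hμ0.le (by linarith)) (by linarith)
  have h4 : δ * μ ^ 2 / 2 * U ≤ δ * μ ^ 2 / 2 * (θ * G) :=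
    mul_le_mul_of_nonneg_left hU (by positivity)
  have h5 := mul_neg_of_neg_of_pos hμ hG
  nlinarith

theorem lq_exact_recovery {n p : ℕ} (q : ℝ) (hq0 : 0 < q) (hq1 : q < 1)
    (k : ℕ) (hk : 0 < k) (s : ℝ) (hs : 0 < s)
    (A : Matrix (Fin n) (Fin p) ℝ) (x xhat : Fin p → ℝ) (y : Fin n → ℝ)
    (hx : Sparse k x) (hy : y = A.mulVec x)
    (hric : ric A ⌈(s ^ q + 1) * (k : ℝ)⌉₊ < 1 / Real.sqrt (s ^ (q - 2) + 1))
    (hfeas : A.mulVec xhat = y)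
    (hmin : ∀ w : Fin p → ℝ, A.mulVec w = y → lqq q xhat ≤ lqq q w) :
    xhat = x := by
  classical
  have hθ : 0 < s ^ (q - 2) := Real.rpow_pos_of_pos hs _
  have hsq : 0 < s ^ q := Real.rpow_pos_of_pos hs q
  have hk' : (0 : ℝ) < k := by exact_mod_cast hk
  obtain ⟨δ, hδlt, hδ0, hrip⟩ := aux_ric A _ _ hric
  have hd : δ ^ 2 * (1 + s ^ (q - 2)) < 1 := by
    have hsp : 0 < s ^ (q - 2) + 1 := by linarith
    rw [lt_div_iff₀ (Real.sqrt_pos.2 hsp)] at hδlt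
    have h1 : (δ * √(s ^ (q - 2) + 1)) ^ 2 < 1 := by
      have : 0 ≤ δ * √(s ^ (q - 2) + 1) := by positivity
      nlinarith
    rw [mul_pow, Real.sq_sqrt hsp.le] at h1
    linarith
  set l : ℕ := ⌈s ^ q * (k : ℝ)⌉₊ with hl
  have hceil : ⌈(s ^ q + 1) * (k : ℝ)⌉₊ = l + k := by
    rw [add_mul, one_mul, Nat.ceil_add_natCast (by positivity)]
  rw [hceil] at hrip
  have hlle : s ^ q * k ≤ l := Nat.le_ceil _
  have hl0 : (0 : ℝ) < l := lt_of_lt_of_le (by positivity) hlle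
  set T : Finset (Fin p) := Finset.univ.filter (fun i => x i ≠ 0) with hTdef
  have hTcard : T.card ≤ k := by
    have := hx
    unfold Sparse l0 at this
    convert this
  have hT0 : ∀ i ∉ T, x i = 0 := by intro i hi; simpa [hTdef] using hi
  set h : Fin p → ℝ := fun i => xhat i - x i with hh
  have hcone : ∑ i ∈ Tᶜ, |h i| ^ q ≤ ∑ i ∈ T, |h i| ^ q :=
    aux_cone q hq0 hq1 x xhat T hT0 (hmin x hy.symm)
  have hAh : A.mulVec h = 0 := by
    have : h = xhat - x := rfl
    rw [this, Matrix.mulVec_sub, hfeas, hy, sub_self]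
  set R := ∑ i ∈ T, |h i| ^ q with hR
  have hterm : ∀ i, 0 ≤ |h i| ^ q := fun i => Real.rpow_nonneg (abs_nonneg _) _
  have hR0 : 0 ≤ R := Finset.sum_nonneg fun i _ => hterm i
  by_contra hne
  have hRpos : 0 < R := by
    rcases hR0.lt_or_eq with h1 | h1
    · exact h1
    exfalso
    apply hne
    have hz : ∑ i, |h i| ^ q ≤ 0 := by
      rw [← Finset.sum_add_sum_compl T]; linarith
    have hz' := (Finset.sum_eq_zero_iff_of_nonneg (fun i _ => hterm i)).1
      (le_antisymm hz (Finset.sum_nonneg fun i _ => hterm i))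
    funext i
    have h2 := (Real.rpow_eq_zero (abs_nonneg _) hq0.ne').1 (hz' i (Finset.mem_univ i))
    have h3 : xhat i - x i = 0 := abs_eq_zero.1 h2
    linarith
  set a : ℝ := (R / l) ^ (1 / q) with ha'
  have ha : 0 < a := Real.rpow_pos_of_pos (by positivity) _
  have haq : l * a ^ q = R := by
    rw [ha', ← Real.rpow_mul (by positivity), one_div_mul_cancel hq0.ne', Real.rpow_one]
    field_simp
  have haqpos : 0 < a ^ q := Real.rpow_pos_of_pos ha q
  set M : Finset (Fin p) := Tᶜ.filter (fun i => a < |h i|) with hM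
  set W : Finset (Fin p) := Tᶜ.filter (fun i => ¬ a < |h i|) with hW
  have hMW : ∑ i ∈ M, |h i| ^ q + ∑ i ∈ W, |h i| ^ q = ∑ i ∈ Tᶜ, |h i| ^ q :=
    Finset.sum_filter_add_sum_filter_not _ _ _
  have hMge : (M.card : ℝ) * a ^ q ≤ ∑ i ∈ M, |h i| ^ q := by
    rw [← nsmul_eq_mul]
    apply Finset.card_nsmul_le_sum
    intro i hi
    exact Real.rpow_le_rpow ha.le (Finset.mem_filter.1 hi).2.le hq0.le
  have hWnn : 0 ≤ ∑ i ∈ W, |h i| ^ q := Finset.sum_nonneg fun i _ => hterm i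
  have hMl : M.card ≤ l := by
    have : (M.card : ℝ) * a ^ q ≤ l * a ^ q := by linarith
    exact_mod_cast le_of_mul_le_mul_right this haqpos
  obtain ⟨N, hN⟩ := Nat.exists_eq_add_of_le hMl
  have hN' : (l : ℝ) = M.card + N := by exact_mod_cast hN
  have hWq : ∑ i ∈ W, |h i| ^ q ≤ N * a ^ q := by
    have : (l : ℝ) * a ^ q = M.card * a ^ q + N * a ^ q := by rw [hN']; ring
    linarith
  have hW1 : ∑ i ∈ W, |h i| ≤ N * a := by
    have haa : a ^ (1 - q) * a ^ q = a := by
      rw [← Real.rpow_add ha]; simp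
    calc ∑ i ∈ W, |h i| ≤ ∑ i ∈ W, a ^ (1 - q) * |h i| ^ q := by
          refine Finset.sum_le_sum fun i hi => ?_
          have hle : |h i| ≤ a := not_lt.1 (Finset.mem_filter.1 hi).2
          rcases (abs_nonneg (h i)).lt_or_eq with h0 | h0
          · calc |h i| = |h i| ^ (1 - q) * |h i| ^ q := by
                  rw [← Real.rpow_add h0]; simp
              _ ≤ _ := mul_le_mul_of_nonneg_right
                  (Real.rpow_le_rpow h0.le hle (by linarith)) (hterm i)
          · rw [← h0, Real.zero_rpow hq0.ne', mul_zero]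
      _ = a ^ (1 - q) * ∑ i ∈ W, |h i| ^ q := by rw [Finset.mul_sum]
      _ ≤ a ^ (1 - q) * (N * a ^ q) :=
          mul_le_mul_of_nonneg_left hWq (Real.rpow_nonneg ha.le _)
      _ = N * (a ^ (1 - q) * a ^ q) := by ring
      _ = N * a := by rw [haa]
  set g : Fin p → ℝ := fun i => if i ∈ W then 0 else h i with hg
  set v : Fin p → ℝ := fun i => if i ∈ W then h i else 0 with hv
  have hgv : g + v = h := by
    funext i
    by_cases hi : i ∈ W <;> simp [hg, hv, hi]
  set c : Fin p → ℝ := - Matrix.vecMul (A.mulVec g) A with hc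
  obtain ⟨u, huN, huv, huU, hcu⟩ := aux_sparse_signed a ha N c v (by
    intro i
    by_cases hi : i ∈ W
    · simp only [hv, hi, if_true]
      exact not_lt.1 (Finset.mem_filter.1 hi).2
    · simp only [hv, hi, if_false, abs_zero]; exact ha.le) (by
    refine le_trans (le_of_eq ?_) hW1
    rw [← Finset.univ_inter W, ← Finset.sum_ite_mem]
    refine Finset.sum_congr rfl fun i _ => ?_
    by_cases hi : i ∈ W
    · simp only [hv, if_pos hi]
    · simp only [hv, if_neg hi, abs_zero])
  have huW : ∀ i ∉ W, u i = 0 := fun i hi => huv i (by simp [hv, hi])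
  have hcw : ∀ w : Fin p → ℝ, ∑ i, c i * w i = -(A.mulVec g ⬝ᵥ A.mulVec w) := by
    intro w
    rw [Matrix.dotProduct_mulVec, ← neg_dotProduct]
    rfl
  rw [hcw, hcw] at hcu
  have hAv : A.mulVec v = - A.mulVec g := by
    have : A.mulVec g + A.mulVec v = 0 := by rw [← Matrix.mulVec_add, hgv, hAh]
    exact eq_neg_of_add_eq_zero_right this
  rw [hAv, dotProduct_neg, neg_neg] at hcu
  have hspr : ∀ α β : ℝ, Sparse (l + k) (α • g + β • u) := by
    intro α β
    unfold Sparse l0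
    have hsub : Finset.univ.filter (fun i => (α • g + β • u) i ≠ 0) ⊆
        T ∪ M ∪ Finset.univ.filter (fun i => u i ≠ 0) := by
      intro i hi
      simp only [Finset.mem_filter, Finset.mem_univ, true_and, Pi.add_apply, Pi.smul_apply,
        smul_eq_mul] at hi
      by_contra hcon
      simp only [Finset.mem_union, Finset.mem_filter, Finset.mem_univ, true_and, not_or,
        not_not] at hcon
      obtain ⟨⟨hiT, hiM⟩, hiu⟩ := hcon
      have hiW : i ∈ W := by
        simp only [hM, hW, Finset.mem_filter, Finset.mem_compl] at hiM ⊢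
        tauto
      apply hi
      simp [hg, hiW, hiu]
    have h1 := Finset.card_le_card hsub
    have h2 := Finset.card_union_le (T ∪ M) (Finset.univ.filter (fun i => u i ≠ 0))
    have h3 := Finset.card_union_le T M
    have h4 : (Finset.univ.filter (fun i => (α • g + β • u) i ≠ 0)).card ≤ l + k := by omega
    convert h4
  have hnorm : ∀ α β : ℝ, ∑ i, ((α • g + β • u) i) ^ 2 =
      α ^ 2 * ∑ i, (g i) ^ 2 + β ^ 2 * ∑ i, (u i) ^ 2 := by
    intro α β
    rw [Finset.mul_sum, Finset.mul_sum, ← Finset.sum_add_distrib]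
    refine Finset.sum_congr rfl fun i _ => ?_
    simp only [Pi.add_apply, Pi.smul_apply, smul_eq_mul]
    by_cases hi : i ∈ W
    · have : g i = 0 := if_pos hi
      rw [this]; ring
    · rw [huW i hi]; ring
  have hAnorm : ∀ α β : ℝ, ∑ i, (A.mulVec (α • g + β • u) i) ^ 2 =
      α ^ 2 * (A.mulVec g ⬝ᵥ A.mulVec g) + 2 * α * β * (A.mulVec g ⬝ᵥ A.mulVec u) +
      β ^ 2 * (A.mulVec u ⬝ᵥ A.mulVec u) := by
    intro α β
    rw [Matrix.mulVec_add, Matrix.mulVec_smul, Matrix.mulVec_smul]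
    simp only [dotProduct]
    rw [Finset.mul_sum, Finset.mul_sum, Finset.mul_sum, ← Finset.sum_add_distrib,
      ← Finset.sum_add_distrib]
    refine Finset.sum_congr rfl fun i _ => ?_
    simp only [Pi.add_apply, Pi.smul_apply, smul_eq_mul]
    ring
  have hTG : ∑ i ∈ T, (h i) ^ 2 ≤ ∑ i, (g i) ^ 2 := by
    calc ∑ i ∈ T, (h i) ^ 2 = ∑ i ∈ T, (g i) ^ 2 := by
          refine Finset.sum_congr rfl fun i hi => ?_
          have : i ∉ W := by
            intro hiW
            exact (Finset.mem_compl.1 (Finset.mem_filter.1 hiW).1) hi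
          simp [hg, this]
      _ ≤ _ := Finset.sum_le_sum_of_subset_of_nonneg (Finset.subset_univ _)
          (fun i _ _ => sq_nonneg _)
  have hpow := aux_power q hq0 hq1 h T k l hk hTcard s hs hlle a ha haq
  have hU : ∑ i, (u i) ^ 2 ≤ s ^ (q - 2) * ∑ i, (g i) ^ 2 := by
    have h1 : (N : ℝ) * a ^ 2 ≤ l * a ^ 2 := by
      apply mul_le_mul_of_nonneg_right _ (sq_nonneg a)
      rw [hN']
      have : (0 : ℝ) ≤ M.card := Nat.cast_nonneg _
      linarith
    have h2 := mul_le_mul_of_nonneg_left hTG hθ.le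
    linarith
  have hG : 0 < ∑ i, (g i) ^ 2 := by
    refine lt_of_lt_of_le ?_ hTG
    have h1 : 0 < (l : ℝ) * a ^ 2 := by positivity
    exact pos_of_mul_pos_right (lt_of_lt_of_le h1 hpow) hθ.le
  refine aux_scalar δ (s ^ (q - 2)) (∑ i, (g i) ^ 2) (∑ i, (u i) ^ 2)
    (A.mulVec g ⬝ᵥ A.mulVec g) (A.mulVec g ⬝ᵥ A.mulVec u) (A.mulVec u ⬝ᵥ A.mulVec u)
    hδ0 hθ hd hG hU (by linarith) ?_ ?_
  · intro α β
    have := (hrip _ (hspr α β)).2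
    rwa [hnorm, hAnorm] at this
  · intro α β
    have := (hrip _ (hspr α β)).1
    rwa [hnorm, hAnorm] at this
end

section
/- Let α > 0 and let t be a positive integer. Define T(α,t) = {v ∈ ℝ^p : ‖v‖_∞ ≤ α, ‖v‖_1 ≤ tα}, and for v ∈ ℝ^p define U(α,t,v) = {u ∈ ℝ^p : supp(u) ⊆ supp(v), ‖u‖_0 ≤ t, ‖u‖_1 = ‖v‖_1, ‖u‖_∞ ≤ α}. Then v ∈ T(α,t) if and only if v lies in the convex hull of U(α,t,v). In particular, any v ∈ T(α,t) can be written as v = Σ_{i=1}^N λ_i u_i with 0 ≤ λ_i ≤ 1, Σ_{i=1}^N λ_i = 1, and each u_i ∈ U(α,t,v). -/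
open scoped BigOperators

theorem linf_iff {p : ℕ} {α : ℝ} (hα : 0 < α) (v : Fin p → ℝ) :
    linfNorm v ≤ α ↔ ∀ i, |v i| ≤ α := by
  unfold linfNorm
  constructor
  · intro h i
    exact (le_ciSup (f := fun i => |v i|) (Set.finite_range _).bddAbove i).trans h
  · intro h
    exact Real.iSup_le h hα.le

/-- The set `U(α,t,v)`, with the sup norm unfolded. -/
def USet {p : ℕ} (α : ℝ) (t : ℕ) (v : Fin p → ℝ) : Set (Fin p → ℝ) :=
  {u | (∀ i, u i ≠ 0 → v i ≠ 0) ∧ l0 u ≤ t ∧ l1Norm u = l1Norm v ∧ ∀ i, |u i| ≤ α}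

theorem USet_mono {p : ℕ} {α : ℝ} {t : ℕ} {v w : Fin p → ℝ}
    (h : ∀ i, w i ≠ 0 → v i ≠ 0) (h1 : l1Norm w = l1Norm v) : USet α t w ⊆ USet α t v := by
  rintro u ⟨a, b, c, d⟩
  exact ⟨fun i hi => h i (a i hi), b, c.trans h1, d⟩

open Classical in
/-- Coordinates with absolute value strictly between `0` and `α`. -/
noncomputable def fracSet {p : ℕ} (α : ℝ) (v : Fin p → ℝ) : Finset (Fin p) :=
  Finset.univ.filter (fun i => v i ≠ 0 ∧ |v i| < α)

theorem l1_le {p : ℕ} {α : ℝ} (u : Fin p → ℝ) (h : ∀ i, |u i| ≤ α) :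
    l1Norm u ≤ l0 u * α := by
  classical
  unfold l1Norm l0
  rw [← Finset.sum_filter_of_ne (p := fun i => u i ≠ 0) (by intro i _ hi; simpa using hi)]
  have := Finset.sum_le_card_nsmul (Finset.univ.filter (fun i => u i ≠ 0)) (fun i => |u i|) α
    (fun i _ => h i)
  rw [nsmul_eq_mul] at this
  convert this

theorem base_case {p : ℕ} {α : ℝ} (hα : 0 < α) {t : ℕ} (v : Fin p → ℝ)
    (h : ∀ i, |v i| ≤ α) (h1 : l1Norm v ≤ t * α) (hc : (fracSet α v).card ≤ 1) :
    l0 v ≤ t := by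
  classical
  by_contra! hlt
  have hA : ∃ S : Finset (Fin p), S = Finset.univ.filter (fun i => v i ≠ 0) := ⟨_, rfl⟩
  obtain ⟨S, hS⟩ := hA
  have hl0 : l0 v = S.card := by rw [hS]; unfold l0; congr
  have hsum : l1Norm v = ∑ i ∈ S, |v i| := by
    rw [hS]; unfold l1Norm
    rw [Finset.sum_filter_of_ne]; intro i _ hi; simpa using hi
  have hFS : fracSet α v ⊆ S := by
    intro i hi
    simp only [fracSet, Finset.mem_filter] at hi
    simp [hS, hi.2.1]
  have hsd : ∑ i ∈ S \ fracSet α v, |v i| = ((S \ fracSet α v).card : ℝ) * α := by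
    rw [Finset.sum_congr rfl (g := fun _ => α), Finset.sum_const, nsmul_eq_mul]
    intro i hi
    simp only [hS, fracSet, Finset.mem_sdiff, Finset.mem_filter, Finset.mem_univ, true_and,
      not_and, not_lt] at hi
    exact le_antisymm (h i) (hi.2 hi.1)
  have hsplit := Finset.sum_sdiff (f := fun i => |v i|) hFS
  have hcard := Finset.card_sdiff_add_card_eq_card hFS
  have hF0 : 0 ≤ ∑ i ∈ fracSet α v, |v i| := Finset.sum_nonneg (fun _ _ => abs_nonneg _)
  rcases (fracSet α v).eq_empty_or_nonempty with he | hne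
  · have h2 : (t : ℝ) + 1 ≤ ((S \ fracSet α v).card : ℝ) := by
      rw [he, Finset.card_empty] at hcard
      rw [he]
      exact_mod_cast (by omega : t + 1 ≤ (S \ ∅).card)
    nlinarith
  · have h2 : (t : ℝ) ≤ ((S \ fracSet α v).card : ℝ) := by
      exact_mod_cast (by omega : t ≤ (S \ fracSet α v).card)
    have hp : 0 < ∑ i ∈ fracSet α v, |v i| := by
      apply Finset.sum_pos _ hne
      intro i hi
      simp only [fracSet, Finset.mem_filter] at hi
      exact abs_pos.2 hi.2.1
    nlinarith

/-- Redistribute the mass of coordinates `i`, `j`. -/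
noncomputable def shift {p : ℕ} (v : Fin p → ℝ) (i j : Fin p) (x : ℝ) : Fin p → ℝ :=
  fun k => if k = i then SignType.sign (v i) * x else
    if k = j then SignType.sign (v j) * (|v i| + |v j| - x) else v k

theorem abs_sign_mul {a x : ℝ} (ha : a ≠ 0) (hx : 0 ≤ x) :
    |(SignType.sign a : ℝ) * x| = x := by
  rcases lt_or_gt_of_ne ha with h | h
  · simp [sign_neg h, abs_of_nonneg hx]
  · simp [sign_pos h, abs_of_nonneg hx]

theorem shift_l1 {p : ℕ} {v : Fin p → ℝ} {i j : Fin p} (hij : i ≠ j) (hi : v i ≠ 0)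
    (hj : v j ≠ 0) {x : ℝ} (hx : 0 ≤ x) (hx2 : x ≤ |v i| + |v j|) :
    l1Norm (shift v i j x) = l1Norm v := by
  classical
  have key : ∀ u : Fin p → ℝ, l1Norm u = |u i| + (|u j| +
      ∑ k ∈ (Finset.univ.erase i).erase j, |u k|) := by
    intro u
    unfold l1Norm
    rw [← Finset.add_sum_erase _ _ (Finset.mem_univ i),
      ← Finset.add_sum_erase (Finset.univ.erase i) _ (Finset.mem_erase.2 ⟨hij.symm, Finset.mem_univ j⟩)]
  rw [key, key v]
  have e1 : |shift v i j x i| = x := by simp [shift, abs_sign_mul hi hx]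
  have e2 : |shift v i j x j| = |v i| + |v j| - x := by
    simp only [shift, hij.symm, if_true, if_false]
    exact abs_sign_mul hj (by linarith)
  have e3 : ∑ k ∈ (Finset.univ.erase i).erase j, |shift v i j x k| =
      ∑ k ∈ (Finset.univ.erase i).erase j, |v k| := by
    apply Finset.sum_congr rfl
    intro k hk
    simp only [Finset.mem_erase] at hk
    simp [shift, hk.1, hk.2.1]
  rw [e1, e2, e3]; ring

theorem shift_abs {p : ℕ} {α : ℝ} {v : Fin p → ℝ} (h : ∀ k, |v k| ≤ α) {i j : Fin p}
    (hi : v i ≠ 0) (hj : v j ≠ 0) {x : ℝ} (hx : 0 ≤ x) (hx2 : x ≤ |v i| + |v j|)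
    (hx3 : x ≤ α) (hx4 : |v i| + |v j| - α ≤ x) (k : Fin p) : |shift v i j x k| ≤ α := by
  unfold shift
  split_ifs
  · rw [abs_sign_mul hi hx]; exact hx3
  · rw [abs_sign_mul hj (by linarith)]; linarith
  · exact h k

theorem shift_supp {p : ℕ} {v : Fin p → ℝ} {i j : Fin p}
    (hi : v i ≠ 0) (hj : v j ≠ 0) {x : ℝ} (k : Fin p) (hk : shift v i j x k ≠ 0) : v k ≠ 0 := by
  unfold shift at hk
  split_ifs at hk with h1 h2
  · rwa [h1]
  · rwa [h2]
  · exact hk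

theorem shift_frac {p : ℕ} {α : ℝ} {v : Fin p → ℝ} {i j : Fin p} (hij : i ≠ j)
    (hi : i ∈ fracSet α v) (hj : j ∈ fracSet α v) {x : ℝ} (hx : 0 ≤ x)
    (hx2 : x ≤ |v i| + |v j|)
    (he : (x = 0 ∨ x = α) ∨ (x = |v i| + |v j| ∨ x = |v i| + |v j| - α)) :
    (fracSet α (shift v i j x)).card < (fracSet α v).card := by
  classical
  simp only [fracSet, Finset.mem_filter, Finset.mem_univ, true_and] at hi hj
  have hsub : fracSet α (shift v i j x) ⊆ fracSet α v := by
    intro k hk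
    simp only [fracSet, Finset.mem_filter, Finset.mem_univ, true_and] at hk ⊢
    refine ⟨shift_supp hi.1 hj.1 k hk.1, ?_⟩
    by_cases h1 : k = i
    · rw [h1]; exact hi.2
    by_cases h2 : k = j
    · rw [h2]; exact hj.2
    simpa [shift, h1, h2] using hk.2
  apply Finset.card_lt_card
  refine ⟨hsub, fun hsup => ?_⟩
  have mi : i ∈ fracSet α (shift v i j x) := hsup (by simp [fracSet, hi])
  have mj : j ∈ fracSet α (shift v i j x) := hsup (by simp [fracSet, hj])
  simp only [fracSet, Finset.mem_filter, Finset.mem_univ, true_and, ← abs_pos] at mi mj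
  have e1 : |shift v i j x i| = x := by simp [shift, abs_sign_mul hi.1 hx]
  have e2 : |shift v i j x j| = |v i| + |v j| - x := by
    simp only [shift, hij.symm, if_true, if_false]
    exact abs_sign_mul hj.1 (by linarith)
  rw [e1] at mi
  rw [e2] at mj
  rcases he with (h | h) | (h | h) <;> linarith [mi.1, mi.2, mj.1, mj.2]

theorem forward {p : ℕ} {α : ℝ} (hα : 0 < α) {t : ℕ} : ∀ (n : ℕ) (v : Fin p → ℝ),
    (fracSet α v).card ≤ n → (∀ i, |v i| ≤ α) → l1Norm v ≤ t * α →
    v ∈ convexHull ℝ (USet α t v) := by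
  intro n
  induction n with
  | zero =>
    intro v hc h h1
    exact subset_convexHull ℝ _ ⟨fun _ h => h, base_case hα v h h1 (by omega), rfl, h⟩
  | succ n ih =>
    intro v hc h h1
    by_cases hc1 : (fracSet α v).card ≤ 1
    · exact subset_convexHull ℝ _ ⟨fun _ h => h, base_case hα v h h1 hc1, rfl, h⟩
    obtain ⟨i, hi, j, hj, hij⟩ := Finset.one_lt_card.1 (not_le.1 hc1)
    have hi' := hi
    have hj' := hj
    simp only [fracSet, Finset.mem_filter, Finset.mem_univ, true_and] at hi' hj'
    have pi := abs_pos.2 hi'.1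
    have pj := abs_pos.2 hj'.1
    have key : ∀ x, 0 ≤ x → x ≤ |v i| + |v j| → x ≤ α → |v i| + |v j| - α ≤ x →
        ((x = 0 ∨ x = α) ∨ (x = |v i| + |v j| ∨ x = |v i| + |v j| - α)) →
        shift v i j x ∈ convexHull ℝ (USet α t v) := by
      intro x a b c d e
      have hl := shift_l1 hij hi'.1 hj'.1 a b
      refine convexHull_mono (USet_mono (shift_supp hi'.1 hj'.1) hl) (ih _ ?_ ?_ ?_)
      · have := shift_frac hij hi hj a b e
        omega
      · exact shift_abs h hi'.1 hj'.1 a b c d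
      · rw [hl]; exact h1
    obtain ⟨lo, hlo⟩ : ∃ lo, lo = max 0 (|v i| + |v j| - α) := ⟨_, rfl⟩
    obtain ⟨hh, hhh⟩ : ∃ hh, hh = min α (|v i| + |v j|) := ⟨_, rfl⟩
    have l1 : lo < |v i| := by rw [hlo]; exact max_lt pi (by linarith)
    have l2 : |v i| < hh := by rw [hhh]; exact lt_min hi'.2 (by linarith)
    have l3 : 0 ≤ lo := by rw [hlo]; exact le_max_left _ _
    have l4 : |v i| + |v j| - α ≤ lo := by rw [hlo]; exact le_max_right _ _
    have l5 : hh ≤ α := by rw [hhh]; exact min_le_left _ _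
    have l6 : hh ≤ |v i| + |v j| := by rw [hhh]; exact min_le_right _ _
    have m1 := key lo l3 (by linarith) (by linarith) l4 (by
      rcases max_choice 0 (|v i| + |v j| - α) with e | e <;> rw [e] at hlo <;> simp [hlo])
    have m2 := key hh (by linarith) l6 l5 (by linarith) (by
      rcases min_choice α (|v i| + |v j|) with e | e <;> rw [e] at hhh <;> simp [hhh])
    have hd : 0 < hh - lo := by linarith
    have hv : v = ((hh - |v i|) / (hh - lo)) • shift v i j lo +
        ((|v i| - lo) / (hh - lo)) • shift v i j hh := by
      have si : (SignType.sign (v i) : ℝ) * |v i| = v i := sign_mul_abs _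
      have sj : (SignType.sign (v j) : ℝ) * |v j| = v j := sign_mul_abs _
      funext k
      simp only [Pi.add_apply, Pi.smul_apply, smul_eq_mul, shift]
      split_ifs with c1 c2
      · rw [c1]
        nth_rewrite 1 [← si]
        field_simp
        ring
      · rw [c2]
        nth_rewrite 1 [← sj]
        field_simp
        ring
      · field_simp
        ring
    rw [hv]
    rw [← hv]
    have := (convex_convexHull ℝ (USet α t v)) m1 m2
      (a := (hh - |v i|) / (hh - lo)) (b := (|v i| - lo) / (hh - lo))
      (div_nonneg (by linarith) hd.le) (div_nonneg (by linarith) hd.le)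
      (by field_simp; ring)
    rwa [← hv] at this

theorem backward {p : ℕ} {α : ℝ} (hα : 0 < α) {t : ℕ} (v : Fin p → ℝ)
    (hv : v ∈ convexHull ℝ (USet α t v)) : (∀ i, |v i| ≤ α) ∧ l1Norm v ≤ t * α := by
  constructor
  · intro i
    have hc : Convex ℝ {u : Fin p → ℝ | u i ∈ Set.Icc (-α) α} :=
      (convex_Icc (-α) α).linear_preimage (LinearMap.proj (R := ℝ) (φ := fun _ : Fin p => ℝ) i)
    have := convexHull_min (s := USet α t v) (fun u hu => abs_le.1 (hu.2.2.2 i)) hc hv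
    exact abs_le.2 this
  · obtain ⟨u, hu⟩ := convexHull_nonempty_iff.1 ⟨v, hv⟩
    rw [← hu.2.2.1]
    refine (l1_le u hu.2.2.2).trans ?_
    have : (l0 u : ℝ) ≤ t := by exact_mod_cast hu.2.1
    exact mul_le_mul_of_nonneg_right this hα.le

/-- **Lemma 2 (sparse representation of a polytope).** `v ∈ T(α,t)` iff `v` lies in the
convex hull of `U(α,t,v)`; in particular any `v ∈ T(α,t)` is a finite convex combination
of elements of `U(α,t,v)`. -/
theorem sparse_representation_of_polytope {p : ℕ} (α : ℝ) (hα : 0 < α)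
    (t : ℕ) (ht : 0 < t) (v : Fin p → ℝ) :
    ((linfNorm v ≤ α ∧ l1Norm v ≤ (t : ℝ) * α) ↔
      v ∈ convexHull ℝ {u : Fin p → ℝ |
        (∀ i, u i ≠ 0 → v i ≠ 0) ∧ l0 u ≤ t ∧ l1Norm u = l1Norm v ∧ linfNorm u ≤ α}) ∧
    ((linfNorm v ≤ α ∧ l1Norm v ≤ (t : ℝ) * α) →
      ∃ (N : ℕ) (lam : Fin N → ℝ) (u : Fin N → Fin p → ℝ),
        (∀ i, 0 ≤ lam i ∧ lam i ≤ 1) ∧ (∑ i, lam i) = 1 ∧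
        (∀ i, (∀ j, u i j ≠ 0 → v j ≠ 0) ∧ l0 (u i) ≤ t ∧
          l1Norm (u i) = l1Norm v ∧ linfNorm (u i) ≤ α) ∧
        v = ∑ i, lam i • u i) := by
  have hU : {u : Fin p → ℝ |
        (∀ i, u i ≠ 0 → v i ≠ 0) ∧ l0 u ≤ t ∧ l1Norm u = l1Norm v ∧ linfNorm u ≤ α} =
      USet α t v := by
    ext u
    simp only [USet, Set.mem_setOf_eq, linf_iff hα]
  rw [hU, linf_iff hα]
  refine ⟨⟨fun h => forward hα _ v le_rfl h.1 h.2, backward hα v⟩, fun h => ?_⟩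
  obtain ⟨ι, _, w, z, hw0, hw1, hz, hs⟩ :=
    mem_convexHull_iff_exists_fintype.1 (forward hα _ v le_rfl h.1 h.2)
  let e := (Fintype.equivFin ι).symm
  refine ⟨Fintype.card ι, fun k => w (e k), fun k => z (e k), fun k => ⟨hw0 _, ?_⟩, ?_, ?_, ?_⟩
  · rw [← hw1]
    exact Finset.single_le_sum (fun i _ => hw0 i) (Finset.mem_univ _)
  · rw [e.sum_comp w, hw1]
  · intro k
    rw [linf_iff hα]
    exact hz (e k)
  · rw [e.sum_comp (fun i => w i • z i), hs]
end
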